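/- For any parity decision tree T on n variables of depth d, E_{ℓ∈T}[(∑_{i=1}^n ℓ_i)²] ≤ 2d, where ℓ ranges over the leaves of T with the distribution induced by a uniform random input. -/

import Mathlib

open Finset

/-- The ±1 sign value of a boolean: `true ↦ 1`, `false ↦ -1`. -/
def bsign (b : Bool) : ℝ := if b then 1 else -1

/-- The parity character `χ_S(x) = ∏_{i ∈ S} x_i` (with `x_i = ±1`), as an integer. -/
def chi {n : ℕ} (S : Finset (Fin n)) (x : Fin n → Bool) : ℤ :=
  ∏ i ∈ S, (if x i then 1 else -1)

/-- Parity decision trees on `n` variables, with leaves labelled in `{-1,1}`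
(encoded as `Bool`, `true ↦ 1`, `false ↦ -1`).  At an internal node labelled `S`,
an input `x` follows the edge labelled `χ_S(x)`: the `tpos` child if `χ_S(x) = 1`
and the `tneg` child if `χ_S(x) = -1`. -/
inductive PDT (n : ℕ) : Type where
  | leaf (b : Bool) : PDT n
  | node (S : Finset (Fin n)) (tneg tpos : PDT n) : PDT n

namespace PDT

variable {n : ℕ}

/-- The depth of the tree: maximum number of internal nodes on a root-to-leaf path. -/
def depth : PDT n → ℕ
  | leaf _ => 0
  | node _ t0 t1 => max (depth t0) (depth t1) + 1

/-- The label of the leaf reached by input `x`. -/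
def eval : PDT n → (Fin n → Bool) → Bool
  | leaf b, _ => b
  | node S t0 t1, x => if chi S x = 1 then eval t1 x else eval t0 x

/-- The identity of the leaf reached by input `x`, recorded as the sequence of
branches taken along the root-to-leaf path. -/
def leafId : PDT n → (Fin n → Bool) → List Bool
  | leaf _, _ => []
  | node S t0 t1, x =>
      if chi S x = 1 then true :: leafId t1 x else false :: leafId t0 x

/-- Number of internal nodes on the root-to-leaf path followed by input `x`. -/
def depthOn : PDT n → (Fin n → Bool) → ℕ
  | leaf _, _ => 0
  | node S t0 t1, x =>
      (if chi S x = 1 then depthOn t1 x else depthOn t0 x) + 1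

/-- `T` computes `f` if every input reaches a leaf labelled `f x`. -/
def Computes (T : PDT n) (f : (Fin n → Bool) → Bool) : Prop :=
  ∀ x, T.eval x = f x

/-- The vector `ℓ ∈ {-1,0,1}^n` associated to the leaf reached by `x`:
`ℓ i` is the average of the `i`-th coordinate (as a `±1` value) over the
uniform distribution on inputs reaching that leaf. -/
noncomputable def leafVec (T : PDT n) (x : Fin n → Bool) (i : Fin n) : ℝ :=
  (∑ y : Fin n → Bool, if T.leafId y = T.leafId x then bsign (y i) else 0) /
    ((Finset.univ.filter fun y : Fin n → Bool => T.leafId y = T.leafId x).card)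

/-- A boolean-valued function `φ` of the input is fixed by the path to the leaf
reached by `x` if it is constant on the set of inputs reaching that leaf. -/
def FixedAt (T : PDT n) (x : Fin n → Bool) (φ : (Fin n → Bool) → Bool) : Prop :=
  ∀ y z : Fin n → Bool, T.leafId y = T.leafId x → T.leafId z = T.leafId x → φ y = φ z

/-- `T` is (pairwise) correlation-free: along any root-to-leaf path, whenever
`x_i ⊕ x_j` (for `i ≠ j`) is fixed, both `x_i` and `x_j` are fixed. -/
def CorrelationFree (T : PDT n) : Prop :=
  ∀ i j : Fin n, i ≠ j → ∀ x : Fin n → Bool,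
    FixedAt T x (fun y => xor (y i) (y j)) →
    FixedAt T x (fun y => y i) ∧ FixedAt T x (fun y => y j)

/-- `T'` refines `T`: the set of inputs reaching any given leaf of `T'` is
contained in the set of inputs reaching some leaf of `T`. -/
def Refines (T' T : PDT n) : Prop :=
  ∀ y z : Fin n → Bool, T'.leafId y = T'.leafId z → T.leafId y = T.leafId z

/-- An ordinary decision tree: every internal node queries a single coordinate. -/
def Ordinary : PDT n → Prop
  | leaf _ => True
  | node S t0 t1 => (∃ i : Fin n, S = {i}) ∧ Ordinary t0 ∧ Ordinary t1

end PDT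

/-- The linear Fourier coefficient `f̂(i) = E_x[f(x)·x_i]` over uniform `x ∈ {-1,1}^n`. -/
noncomputable def fhat {n : ℕ} (f : (Fin n → Bool) → Bool) (i : Fin n) : ℝ :=
  (∑ x : Fin n → Bool, bsign (f x) * bsign (x i)) / 2 ^ n

/-- The index of coordinate `j` of the `i`-th block of `n` consecutive coordinates. -/
def blockIdx {m n : ℕ} (i : Fin m) (j : Fin n) : Fin (m * n) :=
  ⟨i.1 * n + j.1, by
    have hj := j.isLt
    calc i.1 * n + j.1 < i.1 * n + n := by omega
      _ = (i.1 + 1) * n := by ring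
      _ ≤ m * n := Nat.mul_le_mul_right n i.isLt⟩

/-- Composition `f ∘ g` on `m·n` variables, applying `g` to each of the `m` blocks
of `n` consecutive coordinates. -/
def compose {m n : ℕ} (f : (Fin m → Bool) → Bool) (g : (Fin n → Bool) → Bool)
    (x : Fin (m * n) → Bool) : Bool :=
  f fun i => g fun j => x (blockIdx i j)

/-- `MAJ₃`: returns `1` (`true`) iff `x₁ + x₂ + x₃ > 0` for `x ∈ {-1,1}³`. -/
def maj3 (x : Fin 3 → Bool) : Bool :=
  decide (0 < (if x 0 then 1 else -1) + (if x 1 then 1 else -1) + (if x 2 then (1 : ℤ) else -1))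

/-- The recursive majority function `MAJ₃^{⊗k}`, with `MAJ₃^{⊗1} = MAJ₃` and
`MAJ₃^{⊗k}` applying `MAJ₃` to `MAJ₃^{⊗(k-1)}` evaluated on the three blocks of
`3^{k-1}` consecutive coordinates. -/
def recMaj : (k : ℕ) → (Fin (3 ^ k) → Bool) → Bool
  | 0, x => x ⟨0, by norm_num⟩
  | k + 1, x => maj3 fun b =>
      recMaj k fun j => x ⟨b.1 * 3 ^ k + j.1, by
        have hb := b.isLt
        have hj := j.isLt
        calc b.1 * 3 ^ k + j.1 < b.1 * 3 ^ k + 3 ^ k := by omega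
          _ = (b.1 + 1) * 3 ^ k := by ring
          _ ≤ 3 * 3 ^ k := Nat.mul_le_mul_right (3 ^ k) hb
          _ = 3 ^ (k + 1) := by ring⟩

/-- Coordinatewise ternary sum `x ⊕ y ⊕ z` of Boolean vectors. -/
def xor3 {n : ℕ} (x y z : Fin n → Bool) : Fin n → Bool := fun i => xor (x i) (xor (y i) (z i))

/-- A set of Boolean vectors closed under ternary sums, i.e. an affine subspace (or `∅`). -/
def IsAffineSet {n : ℕ} (A : Finset (Fin n → Bool)) : Prop :=
  ∀ x ∈ A, ∀ y ∈ A, ∀ z ∈ A, xor3 x y z ∈ A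

theorem xor3_involutive {n : ℕ} (z w : Fin n → Bool) :
    Function.Involutive fun y => xor3 y z w := by
  intro y
  funext i
  simp only [xor3]
  cases y i <;> cases z i <;> cases w i <;> rfl

theorem bsign_mul_self (a : Bool) : bsign a * bsign a = 1 := by
  cases a <;> norm_num [bsign]

theorem bsign_xor (a b : Bool) : bsign (xor a b) = -(bsign a * bsign b) := by
  cases a <;> cases b <;> norm_num [bsign]

theorem chi_eq_one_or_neg_one {n : ℕ} (S : Finset (Fin n)) (x : Fin n → Bool) :
    chi S x = 1 ∨ chi S x = -1 := by
  unfold chi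
  induction S using Finset.induction_on with
  | empty => simp
  | insert i S hi ih =>
    rw [Finset.prod_insert hi]
    rcases ih with h | h <;> rw [h] <;> cases x i <;> simp

theorem chi_xor3 {n : ℕ} (S : Finset (Fin n)) (x y z : Fin n → Bool) :
    chi S (xor3 x y z) = chi S x * (chi S y * chi S z) := by
  unfold chi
  rw [← Finset.prod_mul_distrib, ← Finset.prod_mul_distrib]
  have hsign : ∀ a b c : Bool, (if xor a (xor b c) then 1 else -1 : ℤ) =
      (if a then 1 else -1) * ((if b then 1 else -1) * (if c then 1 else -1)) := by decide
  exact Finset.prod_congr rfl fun i _ => hsign (x i) (y i) (z i)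

theorem IsAffineSet.filter_chi {n : ℕ} {A : Finset (Fin n → Bool)} (hA : IsAffineSet A)
    (S : Finset (Fin n)) (c : ℤ) : IsAffineSet (A.filter fun y => chi S y = c) := by
  intro x hx y hy z hz
  simp only [Finset.mem_filter] at hx hy hz ⊢
  refine ⟨hA x hx.1 y hy.1 z hz.1, ?_⟩
  rw [chi_xor3, hx.2, hy.2, hz.2]
  rcases chi_eq_one_or_neg_one S x with h | h <;> rw [← hx.2, h] <;> norm_num

theorem IsAffineSet.card_le_two_mul_card_filter_chi {n : ℕ} {A : Finset (Fin n → Bool)}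
    (hA : IsAffineSet A) (S : Finset (Fin n)) {x : Fin n → Bool} (hx : x ∈ A) :
    A.card ≤ 2 * (A.filter fun y => chi S y = chi S x).card := by
  have hsplit := Finset.card_filter_add_card_filter_not (s := A) (fun y => chi S y = chi S x)
  suffices h : (A.filter fun y => ¬ chi S y = chi S x).card ≤
      (A.filter fun y => chi S y = chi S x).card by omega
  rcases (A.filter fun y => ¬ chi S y = chi S x).eq_empty_or_nonempty with h0 | ⟨w, hw⟩
  · simp [h0]
  rw [Finset.mem_filter] at hw
  refine Finset.card_le_card_of_injOn (fun y => xor3 y x w) ?_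
    (xor3_involutive x w).injective.injOn
  intro y hy
  simp only [Finset.coe_filter, Set.mem_ofPred_eq] at hy ⊢
  refine ⟨hA y hy.1 x hx w hw.1, ?_⟩
  rw [chi_xor3]
  have hw2 := hw.2
  have hy2 := hy.2
  rcases chi_eq_one_or_neg_one S x with h | h <;>
  rcases chi_eq_one_or_neg_one S y with h' | h' <;>
  rcases chi_eq_one_or_neg_one S w with h'' | h'' <;>
  simp_all

/-- The part of an affine set reaching a given leaf is affine. -/
theorem IsAffineSet.filter_leafId {n : ℕ} (T : PDT n) {A : Finset (Fin n → Bool)}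
    (hA : IsAffineSet A) (a : List Bool) : IsAffineSet (A.filter fun y => T.leafId y = a) := by
  have key : ∀ (T : PDT n) (a : List Bool) (x y z : Fin n → Bool),
      T.leafId x = a → T.leafId y = a → T.leafId z = a → T.leafId (xor3 x y z) = a := by
    intro T
    induction T with
    | leaf b => intro a x y z hx _ _; exact hx
    | node S t0 t1 ih0 ih1 =>
      intro a x y z hx hy hz
      simp only [PDT.leafId, chi_xor3] at *
      rcases chi_eq_one_or_neg_one S x with h | h <;>
      rcases chi_eq_one_or_neg_one S y with h' | h' <;>
      rcases chi_eq_one_or_neg_one S z with h'' | h'' <;>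
      simp only [h, h', h''] at * <;> norm_num at * <;> subst hx <;> simp_all
  intro x hx y hy z hz
  simp only [Finset.mem_filter] at hx hy hz ⊢
  exact ⟨hA x hx.1 y hy.1 z hz.1, key T a x y z hx.2 hy.2 hz.2⟩

/-- Each leaf of a tree captures at least a `2 ^ (-depth)` fraction of an affine set meeting it. -/
theorem IsAffineSet.card_le_card_filter_leafId {n : ℕ} (T : PDT n) {A : Finset (Fin n → Bool)}
    (hA : IsAffineSet A) {x : Fin n → Bool} (hx : x ∈ A) :
    A.card ≤ 2 ^ T.depth * (A.filter fun y => T.leafId y = T.leafId x).card := by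
  induction T generalizing A with
  | leaf b => simp [PDT.leafId, PDT.depth]
  | node S t0 t1 ih0 ih1 =>
    have h1 := hA.card_le_two_mul_card_filter_chi S hx
    have hB := hA.filter_chi S (chi S x)
    have hxB : x ∈ A.filter fun y => chi S y = chi S x := by simp [hx]
    have step : ∀ t : PDT n, t.depth ≤ max t0.depth t1.depth →
        (A.filter fun y => chi S y = chi S x).card ≤ 2 ^ t.depth *
          ((A.filter fun y => chi S y = chi S x).filter fun y => t.leafId y = t.leafId x).card →
        ((A.filter fun y => chi S y = chi S x).filter fun y => t.leafId y = t.leafId x) ⊆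
          (A.filter fun y => (PDT.node S t0 t1).leafId y = (PDT.node S t0 t1).leafId x) →
        A.card ≤ 2 ^ (PDT.node S t0 t1).depth *
          (A.filter fun y => (PDT.node S t0 t1).leafId y = (PDT.node S t0 t1).leafId x).card := by
      intro t ht hc hsub
      calc A.card ≤ 2 * (A.filter fun y => chi S y = chi S x).card := h1
        _ ≤ 2 * (2 ^ max t0.depth t1.depth * (A.filter fun y =>
            (PDT.node S t0 t1).leafId y = (PDT.node S t0 t1).leafId x).card) := by
          refine Nat.mul_le_mul_left 2 (hc.trans ?_)
          exact Nat.mul_le_mul (Nat.pow_le_pow_right (by norm_num) ht) (Finset.card_le_card hsub)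
        _ = _ := by simp only [PDT.depth]; ring
    by_cases h : chi S x = 1
    · refine step t1 (le_max_right _ _) (ih1 hB hxB) fun y hy => ?_
      simp only [Finset.mem_filter] at hy ⊢
      refine ⟨hy.1.1, ?_⟩
      have hy' := hy.1.2
      simp only [PDT.leafId, hy', h, if_true, hy.2]
    · refine step t0 (le_max_left _ _) (ih0 hB hxB) fun y hy => ?_
      simp only [Finset.mem_filter] at hy ⊢
      refine ⟨hy.1.1, ?_⟩
      have hy' := hy.1.2
      simp only [PDT.leafId, hy', h, if_false, hy.2]

/-- A Boolean function respecting ternary sums is balanced on an affine set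
on which it is not constant. -/
theorem IsAffineSet.sum_bsign_eq_zero {n : ℕ} {A : Finset (Fin n → Bool)} (hA : IsAffineSet A)
    (g : (Fin n → Bool) → Bool)
    (hg : ∀ x y z, g (xor3 x y z) = xor (g x) (xor (g y) (g z)))
    (hne : ¬ ∀ y ∈ A, ∀ z ∈ A, g y = g z) : ∑ y ∈ A, bsign (g y) = 0 := by
  push Not at hne
  obtain ⟨z, hz, w, hw, hzw⟩ := hne
  refine Finset.sum_involution (fun y _ => xor3 y z w) ?_ ?_
    (fun y hy => hA y hy z hz w hw) (fun y _ => xor3_involutive z w y)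
  · intro y _
    rw [hg]
    revert hzw
    cases g y <;> cases g z <;> cases g w <;> simp [bsign]
  · intro y _ _ heq
    have h := hg y z w
    rw [heq] at h
    revert h hzw
    cases g y <;> cases g z <;> cases g w <;> simp

/-- On `A`, the coordinate `i` is not constant, nor is its sum with any other coordinate. -/
def IsFreeCoord {n : ℕ} (A : Finset (Fin n → Bool)) (i : Fin n) : Prop :=
  (¬ ∀ y ∈ A, ∀ z ∈ A, y i = z i) ∧
    ∀ j, j ≠ i → ¬ ∀ y ∈ A, ∀ z ∈ A, xor (y i) (y j) = xor (z i) (z j)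

theorem IsAffineSet.sum_bsign_mul_eq_card {n : ℕ} {A : Finset (Fin n → Bool)}
    (hA : IsAffineSet A) {i : Fin n} (hi : IsFreeCoord A i) {U : Finset (Fin n)} (hU : i ∈ U)
    (c : ℝ) : ∑ y ∈ A, bsign (y i) * (∑ j ∈ U, bsign (y j) - c) = A.card := by
  have h0 : ∑ y ∈ A, bsign (y i) = 0 :=
    hA.sum_bsign_eq_zero (fun y => y i) (fun _ _ _ => rfl) hi.1
  have h1 : ∀ j ∈ U, j ≠ i → ∑ y ∈ A, bsign (y i) * bsign (y j) = 0 := by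
    intro j _ hj
    have := hA.sum_bsign_eq_zero (fun y => xor (y i) (y j))
      (fun x y z => by
        simp only [xor3]
        cases x i <;> cases y i <;> cases z i <;> cases x j <;> cases y j <;> cases z j <;> rfl)
      (hi.2 j hj)
    simpa [bsign_xor] using this
  simp only [mul_sub, Finset.sum_sub_distrib, Finset.mul_sum]
  rw [← Finset.sum_mul, h0, Finset.sum_comm, Finset.sum_eq_single i h1 (fun h => absurd hU h)]
  simp [bsign_mul_self]

theorem IsAffineSet.sum_sum_bsign_mul_eq {n : ℕ} {A : Finset (Fin n → Bool)}
    (hA : IsAffineSet A) {R U : Finset (Fin n)} (hR : ∀ i ∈ R, IsFreeCoord A i) (hRU : R ⊆ U)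
    (c : ℝ) : ∑ y ∈ A, (∑ i ∈ R, bsign (y i)) * (∑ j ∈ U, bsign (y j) - c) =
      R.card * A.card := by
  simp only [Finset.sum_mul]
  rw [Finset.sum_comm, Finset.sum_congr rfl fun i hi =>
    hA.sum_bsign_mul_eq_card (hR i hi) (hRU hi) c]
  simp

/-- Each free coordinate contributes at least `1` to the variance of the coordinate sum. -/
theorem IsAffineSet.card_mul_card_le_sum_sq {n : ℕ} {A : Finset (Fin n → Bool)}
    (hA : IsAffineSet A) {R : Finset (Fin n)} (hR : ∀ i ∈ R, IsFreeCoord A i) (c : ℝ) :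
    (R.card * A.card : ℝ) ≤ ∑ y ∈ A, (∑ j, bsign (y j) - c) ^ 2 := by
  have h1 := hA.sum_sum_bsign_mul_eq hR (Finset.subset_univ R) c
  have h2 := hA.sum_sum_bsign_mul_eq hR (Finset.Subset.refl R) 0
  have h3 : ∑ y ∈ A, (2 * ((∑ i ∈ R, bsign (y i)) * (∑ j, bsign (y j) - c)) -
      (∑ i ∈ R, bsign (y i)) * (∑ j ∈ R, bsign (y j) - 0)) ≤
      ∑ y ∈ A, (∑ j, bsign (y j) - c) ^ 2 := by
    refine Finset.sum_le_sum fun y _ => ?_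
    nlinarith [sq_nonneg ((∑ j, bsign (y j) - c) - ∑ i ∈ R, bsign (y i))]
  rw [Finset.sum_sub_distrib, ← Finset.mul_sum, h1, h2] at h3
  linarith

theorem isFreeCoord_univ {n : ℕ} (i : Fin n) :
    IsFreeCoord (Finset.univ : Finset (Fin n → Bool)) i := by
  refine ⟨fun h => ?_, fun j hj h => ?_⟩
  · simpa using h (fun _ => true) (Finset.mem_univ _) (fun _ => false)
  · have := h (fun _ => true) (Finset.mem_univ _) (fun k => decide (k = i))
      (Finset.mem_univ _)
    simp [hj] at this

theorem sum_sq_sum_bsign (n : ℕ) :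
    ∑ x : Fin n → Bool, (∑ i, bsign (x i)) ^ 2 = n * 2 ^ n := by
  have hA : IsAffineSet (Finset.univ : Finset (Fin n → Bool)) :=
    fun _ _ _ _ _ _ => Finset.mem_univ _
  have := hA.sum_sum_bsign_mul_eq (R := Finset.univ) (fun i _ => isFreeCoord_univ i)
    (Finset.Subset.refl _) 0
  simpa [← sq] using this

/-- A set of at least `2 ^ (n - d)` Boolean vectors has at most `2 * d` non-free coordinates. -/
theorem card_not_isFreeCoord_le {n d : ℕ} {A : Finset (Fin n → Bool)}
    [DecidablePred (IsFreeCoord A)]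
    (hcard : 2 ^ n ≤ 2 ^ d * A.card) :
    (Finset.univ.filter fun i => ¬ IsFreeCoord A i).card ≤ 2 * d := by
  classical
  set Q : Finset (Fin n) := Finset.univ.filter fun i => (∀ y ∈ A, ∀ z ∈ A, y i = z i) ∨
    ∃ j < i, ∀ y ∈ A, ∀ z ∈ A, xor (y i) (y j) = xor (z i) (z j) with hQ
  have hQd : Q.card ≤ d := by
    have hinj : Set.InjOn (fun (y : Fin n → Bool) (i : (Qᶜ : Finset (Fin n))) => y i)
        (A : Set (Fin n → Bool)) := by
      intro y hy z hz hyz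
      funext i
      induction i using WellFoundedLT.induction with
      | ind i ih =>
        by_cases hi : i ∈ Q
        · rw [hQ, Finset.mem_filter] at hi
          rcases hi.2 with h | ⟨j, hj, h⟩
          · exact h y hy z hz
          · have h1 := h y hy z hz
            rw [ih j hj] at h1
            revert h1
            cases y i <;> cases z i <;> cases z j <;> simp
        · exact congrFun hyz ⟨i, by simpa using hi⟩
    have hle : A.card ≤ 2 ^ (n - Q.card) := by
      have := Finset.card_le_card_of_injOn (t := Finset.univ) _
        (fun _ _ => Finset.mem_coe.2 (Finset.mem_univ _)) hinj
      simpa [Finset.card_compl] using this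
    have hQn : Q.card ≤ n := by simpa using Finset.card_le_univ Q
    have h2 : 2 ^ n ≤ 2 ^ (d + (n - Q.card)) := by
      rw [pow_add]
      exact hcard.trans (Nat.mul_le_mul_left _ hle)
    have := (Nat.pow_le_pow_iff_right (by norm_num : 1 < 2)).1 h2
    omega
  set P : Finset (Fin n) := (Finset.univ.filter fun i => ¬ IsFreeCoord A i) \ Q with hP
  have hpart : ∀ i ∈ P, ∃ j ∈ Q, i < j ∧
      ∀ y ∈ A, ∀ z ∈ A, xor (y i) (y j) = xor (z i) (z j) := by
    intro i hi
    simp only [hP, hQ, Finset.mem_sdiff, Finset.mem_filter, Finset.mem_univ, true_and, not_or,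
      not_exists, not_and, IsFreeCoord] at hi
    obtain ⟨hfree, hconst, hlt⟩ := hi
    have hex : ∃ j, j ≠ i ∧ ∀ y ∈ A, ∀ z ∈ A, xor (y i) (y j) = xor (z i) (z j) := by
      by_contra hno
      push Not at hno
      refine hfree hconst fun j hj hall => ?_
      obtain ⟨y, hy, z, hz, hne⟩ := hno j hj
      exact hne (hall y hy z hz)
    obtain ⟨j, hj, h⟩ := hex
    have hij : i < j := lt_of_le_of_ne (not_lt.1 fun hji => hlt j hji h) hj.symm
    refine ⟨j, ?_, hij, h⟩
    rw [hQ, Finset.mem_filter]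
    refine ⟨Finset.mem_univ _, Or.inr ⟨i, hij, fun y hy z hz => ?_⟩⟩
    rw [Bool.xor_comm (y j), Bool.xor_comm (z j)]
    exact h y hy z hz
  choose! f hfQ _ hf using hpart
  have hinjP : ∀ i ∈ P, ∀ k ∈ P, i < k → f i ≠ f k := by
    intro i hi k hk hik heq
    have hkQ : k ∉ Q := (Finset.mem_sdiff.1 hk).2
    refine hkQ ?_
    rw [hQ, Finset.mem_filter]
    refine ⟨Finset.mem_univ _, Or.inr ⟨i, hik, fun y hy z hz => ?_⟩⟩
    have h1 := hf i hi y hy z hz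
    have h2 := hf k hk y hy z hz
    rw [heq] at h1
    revert h1 h2
    cases y i <;> cases z i <;> cases y k <;> cases z k <;> cases y (f k) <;>
      cases z (f k) <;> simp
  have hPQ : P.card ≤ Q.card := by
    refine Finset.card_le_card_of_injOn f hfQ fun i hi k hk heq => ?_
    rcases lt_trichotomy i k with h | h | h
    · exact absurd heq (hinjP i hi k hk h)
    · exact h
    · exact absurd heq.symm (hinjP k hk i hi h)
  calc (Finset.univ.filter fun i => ¬ IsFreeCoord A i).card ≤ P.card + Q.card :=
        Finset.card_le_card_sdiff_add_card
    _ ≤ 2 * d := by omega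

/-- An affine set of codimension at most `d` has coordinate-sum variance at least `n - 2 * d`. -/
theorem IsAffineSet.card_mul_sq_mean_le {n d : ℕ} {A : Finset (Fin n → Bool)}
    (hA : IsAffineSet A) (hcard : 2 ^ n ≤ 2 ^ d * A.card) {m : ℝ}
    (hm : A.card * m = ∑ y ∈ A, ∑ i, bsign (y i)) :
    A.card * m ^ 2 ≤ ∑ y ∈ A, ((∑ i, bsign (y i)) ^ 2 - (n - 2 * d)) := by
  classical
  have hvar := hA.card_mul_card_le_sum_sq
    (R := Finset.univ.filter fun i => IsFreeCoord A i) (by simp) m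
  have hbad := card_not_isFreeCoord_le hcard
  have hsplit := Finset.card_filter_add_card_filter_not
    (s := (Finset.univ : Finset (Fin n))) (fun i => IsFreeCoord A i)
  rw [Finset.card_univ, Fintype.card_fin] at hsplit
  have hR : (n : ℝ) - 2 * d ≤ (Finset.univ.filter fun i => IsFreeCoord A i).card := by
    have : n ≤ (Finset.univ.filter fun i => IsFreeCoord A i).card + 2 * d := by omega
    have : (n : ℝ) ≤ (Finset.univ.filter fun i => IsFreeCoord A i).card + 2 * d := by
      exact_mod_cast this
    linarith
  have hmul := mul_le_mul_of_nonneg_right hR (Nat.cast_nonneg (α := ℝ) A.card)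
  have hexp : ∑ y ∈ A, (∑ j, bsign (y j) - m) ^ 2 =
      ∑ y ∈ A, (∑ j, bsign (y j)) ^ 2 - A.card * m ^ 2 := by
    simp only [sub_sq, Finset.sum_add_distrib, Finset.sum_sub_distrib, ← Finset.sum_mul,
      ← Finset.mul_sum, ← hm, Finset.sum_const, nsmul_eq_mul]
    ring
  rw [Finset.sum_sub_distrib, Finset.sum_const, nsmul_eq_mul]
  linarith

theorem PDT.card_mul_sum_leafVec {n : ℕ} (T : PDT n) (x : Fin n → Bool) :
    ((Finset.univ.filter fun y => T.leafId y = T.leafId x).card : ℝ) * ∑ i, T.leafVec x i =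
      ∑ y ∈ Finset.univ.filter (fun y => T.leafId y = T.leafId x), ∑ i, bsign (y i) := by
  have hne : ((Finset.univ.filter fun y => T.leafId y = T.leafId x).card : ℝ) ≠ 0 :=
    Nat.cast_ne_zero.2 (Finset.card_ne_zero_of_mem (a := x) (by simp))
  rw [Finset.sum_comm, Finset.mul_sum]
  refine Finset.sum_congr rfl fun i _ => ?_
  rw [PDT.leafVec, mul_div_cancel₀ _ hne, Finset.sum_filter]

/-- **Lemma.** For any parity decision tree `T` of depth `d`,
`E_{ℓ∈T}[(∑ᵢ ℓᵢ)²] ≤ 2d`, where the leaf `ℓ` is distributed according to the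
fraction of uniform inputs reaching it. -/
theorem pdt_leaf_second_moment_le {n d : ℕ} (T : PDT n) (hd : T.depth ≤ d) :
    (∑ x : Fin n → Bool, (∑ i : Fin n, T.leafVec x i) ^ 2) / 2 ^ n ≤ 2 * d := by
  have hmain : ∑ x : Fin n → Bool, (∑ i : Fin n, T.leafVec x i) ^ 2 ≤
      ∑ x : Fin n → Bool, ((∑ i, bsign (x i)) ^ 2 - ((n : ℝ) - 2 * d)) := by
    have hmaps : ∀ x ∈ (Finset.univ : Finset (Fin n → Bool)),
        T.leafId x ∈ Finset.univ.image T.leafId :=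
      fun x hx => Finset.mem_image_of_mem _ hx
    rw [← Finset.sum_fiberwise_of_maps_to hmaps, ← Finset.sum_fiberwise_of_maps_to hmaps]
    refine Finset.sum_le_sum fun a ha => ?_
    obtain ⟨x, -, rfl⟩ := Finset.mem_image.1 ha
    have huniv : IsAffineSet (Finset.univ : Finset (Fin n → Bool)) :=
      fun _ _ _ _ _ _ => Finset.mem_univ _
    have hcard := huniv.card_le_card_filter_leafId T (Finset.mem_univ x)
    have hcard' : 2 ^ n ≤ 2 ^ d * (Finset.univ.filter fun y => T.leafId y = T.leafId x).card := by
      rw [Finset.card_univ, Fintype.card_fun, Fintype.card_bool, Fintype.card_fin] at hcard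
      exact hcard.trans (Nat.mul_le_mul_right _ (Nat.pow_le_pow_right (by norm_num) hd))
    refine le_trans (le_of_eq ?_) ((huniv.filter_leafId T (T.leafId x)).card_mul_sq_mean_le
      hcard' (T.card_mul_sum_leafVec x))
    rw [← nsmul_eq_mul, ← Finset.sum_const]
    refine Finset.sum_congr rfl fun y hy => ?_
    have hy' : T.leafId y = T.leafId x := (Finset.mem_filter.1 hy).2
    simp only [PDT.leafVec, hy']
  rw [Finset.sum_sub_distrib, sum_sq_sum_bsign] at hmain
  simp only [Finset.sum_const, Finset.card_univ, Fintype.card_fun, Fintype.card_bool,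
    Fintype.card_fin, nsmul_eq_mul, Nat.cast_pow, Nat.cast_ofNat] at hmain
  rw [div_le_iff₀ (by positivity)]
  linarith
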